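/- arXiv:1703.01756 — 2 statements merged into one kernel-verified Lean document; each statement's English description precedes it below -/
import Mathlib

section
/- Let K be a field, n ≥ 2, and R = K[x_{ij}, y_{ij} : 1 ≤ i, j ≤ n] the polynomial ring in 2n² distinct indeterminates. Let X = (x_{ij}) and Y = (y_{ij}) be the n×n generic matrices and write XY = (f_{ij}), so f_{ij} = Σ_{k=1}^{n} x_{ik} y_{kj}. For 1 ≤ t ≤ n set k_t = 1 + (⌊n/t⌋ − 1)·t (so k_n = 1). Then the set F = {f_{11}, f_{21}, …, f_{n1}} ∪ {f_{12}, f_{32}, …, f_{k_2 2}} ∪ {f_{13}, f_{43}, …, f_{k_3 3}} ∪ … ∪ {f_{1n}}, that is, the collection of all f_{it} with 1 ≤ t ≤ n, i ≡ 1 (mod t), and 1 ≤ i ≤ k_t, is a regular sequence in R. -/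
open MvPolynomial

/-- Auxiliary arithmetic bound: if `j < n / t` and `s < t` then `j * t + s < n`. -/
lemma mul_add_lt_of_lt_div {n t j s : ℕ} (hj : j < n / t) (hs : s < t) :
    j * t + s < n :=
  lt_of_lt_of_le
    (lt_of_lt_of_le (by rw [Nat.succ_mul]; omega)
      (Nat.mul_le_mul_right t (Nat.succ_le_of_lt hj)))
    (Nat.div_mul_le_self n t)

/-- Type synonym carrying the weighted lexicographic order. -/
def WSyn (σ : Type*) (_w : σ → ℕ) := σ →₀ ℕ

noncomputable instance {σ : Type*} (w : σ → ℕ) : AddCommMonoid (WSyn σ w) :=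
  inferInstanceAs (AddCommMonoid (σ →₀ ℕ))

/-- The embedding of exponents that defines the weighted order. -/
noncomputable def WSyn.emb {σ : Type*} (w : σ → ℕ) (a : WSyn σ w) : ℕ ×ₗ Lex (σ →₀ ℕ) :=
  toLex (Finsupp.weight w (show σ →₀ ℕ from a), toLex (show σ →₀ ℕ from a))

lemma WSyn.emb_injective {σ : Type*} (w : σ → ℕ) : Function.Injective (WSyn.emb w) := by
  intro a b h
  exact congrArg (fun z => ofLex (ofLex z).2) h

lemma WSyn.emb_add {σ : Type*} (w : σ → ℕ) (a b : WSyn σ w) :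
    WSyn.emb w (a + b) = WSyn.emb w a + WSyn.emb w b := by
  have : Finsupp.weight w ((show σ →₀ ℕ from a) + (show σ →₀ ℕ from b)) = _ :=
    map_add (Finsupp.weight w) _ _
  exact congrArg (fun z => toLex (z, toLex ((show σ →₀ ℕ from a) + (show σ →₀ ℕ from b)))) this

noncomputable instance {σ : Type*} [LinearOrder σ] (w : σ → ℕ) : LinearOrder (WSyn σ w) :=
  LinearOrder.lift' (WSyn.emb w) (WSyn.emb_injective w)

lemma WSyn.le_iff {σ : Type*} [LinearOrder σ] (w : σ → ℕ) (a b : WSyn σ w) :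
    a ≤ b ↔ WSyn.emb w a ≤ WSyn.emb w b := Iff.rfl

lemma WSyn.lt_iff {σ : Type*} [LinearOrder σ] (w : σ → ℕ) (a b : WSyn σ w) :
    a < b ↔ WSyn.emb w a < WSyn.emb w b := Iff.rfl

instance {σ : Type*} [LinearOrder σ] (w : σ → ℕ) : IsOrderedAddMonoid (WSyn σ w) where
  add_le_add_left a b h c := by
    rw [WSyn.le_iff] at *
    rw [WSyn.emb_add, WSyn.emb_add]
    exact add_le_add_left h _

instance {σ : Type*} [LinearOrder σ] [WellFoundedGT σ] (w : σ → ℕ) :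
    WellFoundedLT (WSyn σ w) :=
  ⟨InvImage.wf (WSyn.emb w) wellFounded_lt⟩

/-- Weighted lexicographic monomial order. -/
noncomputable def wOrder {σ : Type*} [LinearOrder σ] [WellFoundedGT σ] (w : σ → ℕ) :
    MonomialOrder σ where
  syn := WSyn σ w
  toSyn := AddEquiv.refl _
  toSyn_monotone := by
    intro a b h
    obtain ⟨c, rfl⟩ := exists_add_of_le h
    change WSyn.emb w a ≤ WSyn.emb w (show WSyn σ w from a + c)
    have := WSyn.emb_add w a c
    refine le_of_le_of_eq ?_ this.symm
    have h0 : (0 : ℕ ×ₗ Lex (σ →₀ ℕ)) ≤ WSyn.emb w c := by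
      refine Prod.Lex.le_iff.mpr ?_
      rcases Nat.eq_zero_or_pos (Finsupp.weight w c) with h | h
      · right
        exact ⟨h.symm, bot_le⟩
      · left
        exact h
    exact le_add_of_nonneg_right h0

lemma wOrder_lt {σ : Type*} [LinearOrder σ] [WellFoundedGT σ] (w : σ → ℕ) {a b : σ →₀ ℕ}
    (h : Finsupp.weight w a < Finsupp.weight w b) :
    (wOrder w).toSyn a < (wOrder w).toSyn b := by
  change WSyn.emb w a < WSyn.emb w b
  exact Prod.Lex.lt_iff.mpr (Or.inl h)

universe u in
lemma exists_wOrder {σ : Type u} [Fintype σ] (w : σ → ℕ) :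
    ∃ m : MonomialOrder.{u, u} σ, ∀ a b : σ →₀ ℕ, Finsupp.weight w a < Finsupp.weight w b →
      m.toSyn a < m.toSyn b := by
  let _ : LinearOrder σ := LinearOrder.lift' (Fintype.equivFin σ) (Equiv.injective _)
  exact ⟨wOrder w, fun _ _ h => wOrder_lt w h⟩

section coprime
variable {σ K : Type*} [Field K] (m : MonomialOrder σ)

lemma le_of_le_add_disjoint {a b c : σ →₀ ℕ} (h : a ≤ b + c) (hd : Disjoint a.support c.support) :
    a ≤ b := by
  intro s
  by_cases hs : a s = 0
  · rw [hs]; exact Nat.zero_le _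
  · have h1 : s ∉ c.support := Finset.disjoint_left.mp hd (by simpa using hs)
    have := h s
    rw [Finsupp.notMem_support_iff] at h1
    simpa [h1] using this

lemma exists_reduced (l : List (MvPolynomial σ K)) (h0 : ∀ p ∈ l, p ≠ 0) (a : MvPolynomial σ K) :
    ∃ r, a - r ∈ Ideal.ofList l ∧ ∀ c ∈ r.support, ∀ b ∈ l, ¬ m.degree b ≤ c := by
  obtain ⟨g, r, h1, -, h3⟩ := m.div_set (B := {p | p ∈ l})
    (fun b hb => (m.leadingCoeff_ne_zero_iff.mpr (h0 b hb)).isUnit) a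
  refine ⟨r, ?_, h3⟩
  rw [h1, add_sub_cancel_right, Finsupp.linearCombination_apply]
  refine Submodule.sum_mem _ fun c _ => ?_
  exact Submodule.smul_mem _ _ (Ideal.subset_span c.2)

/-- Leading monomials of the ideal are governed by those of `l`. -/
def LeadProp (l : List (MvPolynomial σ K)) : Prop :=
  ∀ h ∈ Ideal.ofList l, h ≠ 0 → ∃ p ∈ l, m.degree p ≤ m.degree h

lemma reduced_mul_ne {l : List (MvPolynomial σ K)} {q a b : MvPolynomial σ K}
    (hl : LeadProp m l) (hq : q ≠ 0)
    (hd : ∀ p ∈ l, Disjoint (m.degree p).support (m.degree q).support)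
    (ha : ∀ c ∈ a.support, ∀ b ∈ l, ¬ m.degree b ≤ c) (ha0 : a ≠ 0)
    (hb : b ∈ Ideal.ofList l) (hb0 : b ≠ 0) : m.degree (a * q) ≠ m.degree b := by
  intro h
  obtain ⟨p, hp, hpb⟩ := hl b hb hb0
  rw [← h, m.degree_mul ha0 hq] at hpb
  exact ha _ (m.degree_mem_support ha0) p hp (le_of_le_add_disjoint hpb (hd p hp))

lemma mem_of_mul_mem {l : List (MvPolynomial σ K)} {q g : MvPolynomial σ K}
    (h0 : ∀ p ∈ l, p ≠ 0) (hl : LeadProp m l) (hq : q ≠ 0)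
    (hd : ∀ p ∈ l, Disjoint (m.degree p).support (m.degree q).support)
    (hg : g * q ∈ Ideal.ofList l) : g ∈ Ideal.ofList l := by
  obtain ⟨r, hr, hr'⟩ := exists_reduced m l h0 g
  by_cases hr0 : r = 0
  · simpa [hr0] using hr
  · exfalso
    have : r * q ∈ Ideal.ofList l := by
      have h2 := Ideal.sub_mem _ hg (Ideal.mul_mem_right q _ hr)
      convert h2 using 1
      ring
    exact reduced_mul_ne m hl hq hd hr' hr0 this (mul_ne_zero hr0 hq) rfl

lemma leadProp_append {l : List (MvPolynomial σ K)} {q : MvPolynomial σ K}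
    (h0 : ∀ p ∈ l, p ≠ 0) (hl : LeadProp m l) (hq : q ≠ 0)
    (hd : ∀ p ∈ l, Disjoint (m.degree p).support (m.degree q).support) :
    LeadProp m (l ++ [q]) := by
  intro h hh hne
  rw [Ideal.ofList_append, Ideal.ofList_singleton] at hh
  obtain ⟨b, hb, c, hc, rfl⟩ := Submodule.mem_sup.mp hh
  obtain ⟨a, rfl⟩ := Ideal.mem_span_singleton'.mp hc
  obtain ⟨r, hr, hr'⟩ := exists_reduced m l h0 a
  obtain ⟨b', hb', heq⟩ : ∃ b' ∈ Ideal.ofList l, b + a * q = b' + r * q :=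
    ⟨b + (a - r) * q, Ideal.add_mem _ hb (Ideal.mul_mem_right q _ hr), by ring⟩
  rw [heq] at hne ⊢
  have hleft : b' ≠ 0 → ∃ p ∈ l ++ [q], m.degree p ≤ m.degree b' := fun hb0 => by
    obtain ⟨p, hp, hp'⟩ := hl b' hb' hb0
    exact ⟨p, by simp [hp], hp'⟩
  have hright : r ≠ 0 → ∃ p ∈ l ++ [q], m.degree p ≤ m.degree (r * q) := fun hr0 => by
    refine ⟨q, by simp, ?_⟩
    rw [m.degree_mul hr0 hq]
    exact le_add_of_nonneg_left zero_le
  by_cases hr0 : r = 0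
  · subst hr0
    simp only [zero_mul, add_zero] at hne ⊢
    exact hleft hne
  by_cases hb0 : b' = 0
  · subst hb0
    simpa using hright hr0
  have hn := reduced_mul_ne m hl hq hd hr' hr0 hb' hb0
  rcases lt_or_gt_of_ne (fun h => hn (m.toSyn.injective h)) with h | h
  · rw [m.degree_add_of_lt h]
    exact hleft hb0
  · rw [m.degree_add_eq_right_of_lt h]
    exact hright hr0

lemma regular_of_disjoint (l : List (MvPolynomial σ K)) (h0 : ∀ p ∈ l, p ≠ 0)
    (hd : l.Pairwise fun p q => Disjoint (m.degree p).support (m.degree q).support) :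
    LeadProp m l ∧ RingTheory.Sequence.IsWeaklyRegular (MvPolynomial σ K) l := by
  induction l using List.reverseRecOn with
  | nil =>
    refine ⟨?_, RingTheory.Sequence.IsWeaklyRegular.nil _ _⟩
    intro h hh hne
    simp at hh
    exact absurd hh hne
  | append_singleton l q ih =>
    rw [List.pairwise_append] at hd
    have h0' : ∀ p ∈ l, p ≠ 0 := fun p hp => h0 p (by simp [hp])
    have hq : q ≠ 0 := h0 q (by simp)
    have hd' : ∀ p ∈ l, Disjoint (m.degree p).support (m.degree q).support :=
      fun p hp => hd.2.2 p hp q (by simp)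
    obtain ⟨h1, h2⟩ := ih h0' hd.1
    refine ⟨leadProp_append m h0' h1 hq hd', ?_⟩
    rw [RingTheory.Sequence.isWeaklyRegular_append_iff,
      RingTheory.Sequence.isWeaklyRegular_singleton_iff]
    refine ⟨h2, ?_⟩
    rw [isSMulRegular_iff_right_eq_zero_of_smul]
    intro x hx
    obtain ⟨g, rfl⟩ := Submodule.Quotient.mk_surjective _ x
    rw [← Submodule.Quotient.mk_smul, Submodule.Quotient.mk_eq_zero] at hx
    rw [Submodule.Quotient.mk_eq_zero]
    rw [smul_eq_mul, Ideal.mul_top] at *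
    rw [smul_eq_mul, mul_comm] at hx
    exact mem_of_mul_mem m h0' h1 hq hd' hx

lemma isRegular_of_disjoint (l : List (MvPolynomial σ K)) (h0 : ∀ p ∈ l, m.degree p ≠ 0)
    (hd : l.Pairwise fun p q => Disjoint (m.degree p).support (m.degree q).support) :
    RingTheory.Sequence.IsRegular (MvPolynomial σ K) l := by
  obtain ⟨h1, h2⟩ := regular_of_disjoint m l (fun p hp => m.ne_zero_of_degree_ne_zero (h0 p hp)) hd
  refine ⟨h2, fun h => ?_⟩
  rw [smul_eq_mul, Ideal.mul_top] at h
  obtain ⟨p, hp, hp'⟩ := h1 1 (h ▸ Submodule.mem_top) one_ne_zero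
  rw [m.degree_one] at hp'
  exact h0 p hp (le_antisymm hp' zero_le)

lemma degree_sum_lead {ι : Type*} [Fintype ι] [DecidableEq ι] (d : ι → σ →₀ ℕ) (k : ι)
    (hk : ∀ j, j ≠ k → m.toSyn (d j) < m.toSyn (d k)) (hk0 : d k ≠ 0) :
    m.degree (∑ j, monomial (d j) (1 : K)) = d k := by
  classical
  rw [← Finset.add_sum_erase _ _ (Finset.mem_univ k)]
  have hdeg : ∀ j, m.degree (monomial (d j) (1 : K)) = d j := fun j => by
    rw [m.degree_monomial, if_neg one_ne_zero]
  rw [m.degree_add_of_lt, hdeg]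
  refine lt_of_le_of_lt m.degree_sum_le ?_
  rw [Finset.sup_lt_iff]
  · intro j hj
    rw [hdeg, hdeg]
    exact hk j (Finset.ne_of_mem_erase hj)
  · rw [hdeg, m.bot_eq_zero, m.toSyn_lt_iff_ne_zero]
    simpa using hk0

end coprime

/-- The weight selecting `x_{i,i+t} y_{i+t,t}` in `f_{i,t}`. -/
def wt (n : ℕ) : (Fin n × Fin n) ⊕ (Fin n × Fin n) → ℕ
  | Sum.inl (i, k) => n * n + 2 * i.1 * k.1 - k.1 * k.1
  | Sum.inr (k, t) => 2 * k.1 * t.1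

/-- Exponent of the monomial `x_{ik} y_{kt}`. -/
noncomputable def expo {n : ℕ} (i t k : Fin n) : ((Fin n × Fin n) ⊕ (Fin n × Fin n)) →₀ ℕ :=
  Finsupp.single (Sum.inl (i, k)) 1 + Finsupp.single (Sum.inr (k, t)) 1

lemma expo_support {n : ℕ} (i t k : Fin n) (s) (hs : s ∈ (expo i t k).support) :
    s = Sum.inl (i, k) ∨ s = Sum.inr (k, t) := by
  classical
  have := Finsupp.support_add hs
  rw [Finset.mem_union] at this
  rcases this with h | h
  · left; simpa using Finsupp.support_single_subset h
  · right; simpa using Finsupp.support_single_subset h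

lemma weight_expo_lt {n : ℕ} (i t k j : Fin n) (hk : k.1 = i.1 + t.1) (hj : j ≠ k) :
    Finsupp.weight (wt n) (expo i t j) < Finsupp.weight (wt n) (expo i t k) := by
  simp only [expo, map_add, Finsupp.weight_single, wt, one_smul]
  have hne : (j.1 : ℤ) - k.1 ≠ 0 := by
    have : j.1 ≠ k.1 := fun h => hj (Fin.ext h)
    omega
  have hpos : 0 < ((j.1 : ℤ) - k.1) ^ 2 := by positivity
  have h1 : j.1 * j.1 ≤ n * n + 2 * i.1 * j.1 :=
    (Nat.mul_le_mul j.2.le j.2.le).trans (Nat.le_add_right _ _)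
  have h2 : k.1 * k.1 ≤ n * n + 2 * i.1 * k.1 :=
    (Nat.mul_le_mul k.2.le k.2.le).trans (Nat.le_add_right _ _)
  zify [h1, h2]
  have hk' : (k.1 : ℤ) = i.1 + t.1 := by exact_mod_cast hk
  have ht : (t.1 : ℤ) = k.1 - i.1 := by linarith
  rw [ht]
  nlinarith

/-- the main theorem.  In `R = K[xᵢⱼ, yᵢⱼ : 1 ≤ i,j ≤ n]` (variables indexed
by `(Fin n × Fin n) ⊕ (Fin n × Fin n)`, the left summand for the `x`'s and the right one
for the `y`'s), with `f i j = Σₖ x i k * y k j` the entries of the product of the two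
generic matrices, the family of all `f_{i t}` with `1 ≤ t ≤ n`, `i ≡ 1 (mod t)` and
`1 ≤ i ≤ k_t = 1 + (⌊n/t⌋ − 1)·t` (in 0-indexed form: column `t`, rows `j·(t+1)` for
`j < ⌊n/(t+1)⌋`), listed column by column, is a regular sequence in `R`. -/
theorem productGenericMatrices_regularSequence
    {K : Type*} [Field K] (n : ℕ) (hn : 2 ≤ n)
    (f : Fin n → Fin n → MvPolynomial ((Fin n × Fin n) ⊕ (Fin n × Fin n)) K)
    (hf : ∀ i j, f i j = ∑ k, X (Sum.inl (i, k)) * X (Sum.inr (k, j))) :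
    RingTheory.Sequence.IsRegular (MvPolynomial ((Fin n × Fin n) ⊕ (Fin n × Fin n)) K)
      (List.ofFn fun t : Fin n =>
        List.ofFn fun j : Fin (n / (t.1 + 1)) =>
          f ⟨j.1 * (t.1 + 1), by
              simpa using mul_add_lt_of_lt_div j.2 (Nat.succ_pos t.1)⟩ t).flatten := by
  classical
  obtain ⟨m, hm⟩ := exists_wOrder (wt n)
  have hne : ∀ i t k : Fin n, expo i t k ≠ 0 := by
    intro i t k h
    have := DFunLike.congr_fun h (Sum.inl (i, k))
    simp [expo] at this
  have hdeg : ∀ i t k : Fin n, k.1 = i.1 + t.1 → m.degree (f i t) = expo i t k := by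
    intro i t k hk
    rw [hf]
    have : ∀ j, (X (Sum.inl (i, j)) * X (Sum.inr (j, t)) :
        MvPolynomial ((Fin n × Fin n) ⊕ (Fin n × Fin n)) K) = monomial (expo i t j) 1 := by
      intro j
      simp [X, monomial_mul, expo]
    simp only [this]
    exact degree_sum_lead m _ k (fun j hj => hm _ _ (weight_expo_lt i t k j hk hj)) (hne _ _ _)
  have hdisj : ∀ i t i' t' : Fin n, i.1 + t.1 < n → i'.1 + t'.1 < n → (i, t) ≠ (i', t') →
      Disjoint (m.degree (f i t)).support (m.degree (f i' t')).support := by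
    intro i t i' t' h h' hneq
    rw [hdeg i t ⟨_, h⟩ rfl, hdeg i' t' ⟨_, h'⟩ rfl, Finset.disjoint_left]
    intro s hs hs'
    apply hneq
    rcases expo_support _ _ _ _ hs with rfl | rfl <;>
      rcases expo_support _ _ _ _ hs' with h2 | h2 <;>
      simp only [Sum.inl.injEq, Sum.inr.injEq, Prod.mk.injEq, Fin.ext_iff, reduceCtorEq] at h2 ⊢ <;>
      omega
  have hb : ∀ (t : Fin n) (j : Fin (n / (t.1 + 1))), j.1 * (t.1 + 1) + t.1 < n :=
    fun t j => mul_add_lt_of_lt_div j.2 (Nat.lt_succ_self _)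
  refine isRegular_of_disjoint m _ ?_ ?_
  · intro p hp
    simp only [List.mem_flatten, List.mem_ofFn] at hp
    obtain ⟨_, ⟨t, rfl⟩, hp⟩ := hp
    obtain ⟨j, rfl⟩ := List.mem_ofFn.mp hp
    rw [hdeg _ t ⟨_, hb t j⟩ rfl]
    exact hne _ _ _
  · rw [List.pairwise_flatten]
    constructor
    · intro l hl
      obtain ⟨t, rfl⟩ := List.mem_ofFn.mp hl
      rw [List.pairwise_ofFn]
      intro a b hab
      refine hdisj _ _ _ _ (hb t a) (hb t b) fun h => ?_
      simp only [Prod.mk.injEq, Fin.mk.injEq, and_true] at h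
      have := Nat.eq_of_mul_eq_mul_right (Nat.succ_pos t.1) h
      have hab' : a.1 < b.1 := hab
      omega
    · rw [List.pairwise_ofFn]
      intro t t' htt p hp q hq
      obtain ⟨a, rfl⟩ := List.mem_ofFn.mp hp
      obtain ⟨b, rfl⟩ := List.mem_ofFn.mp hq
      refine hdisj _ _ _ _ (hb t a) (hb t' b) fun h => ?_
      exact htt.ne (Prod.mk.inj h).2
end

section
/- Let K be a field, n ≥ 2, and R = K[x_{ij}, y_{ij} : 1 ≤ i, j ≤ n], with f_{ij} = Σ_{k=1}^{n} x_{ik} y_{kj} the entries of the product of the n×n generic matrices. Then the first column entries f_{11}, f_{21}, …, f_{n1} form a regular sequence in R. -/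
open MvPolynomial

attribute [local instance] MvPolynomial.gradedAlgebra

/-- `a` is a nonzerodivisor modulo `I`. -/
def NZMod {R : Type*} [CommRing R] (I : Ideal R) (a : R) : Prop := ∀ r, a * r ∈ I → r ∈ I

/-- `l` is a weakly regular sequence modulo `I`. -/
def RegSeq {R : Type*} [CommRing R] : Ideal R → List R → Prop
  | _, [] => True
  | I, a :: l => NZMod I a ∧ RegSeq (I ⊔ Ideal.span {a}) l

theorem RegSeq.get {R : Type*} [CommRing R] (l : List R) : ∀ (I : Ideal R), RegSeq I l →
    ∀ i (h : i < l.length), NZMod (I ⊔ Ideal.ofList (l.take i)) l[i] := by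
  induction l with
  | nil => intro I _ i h; simp at h
  | cons a l ih =>
    intro I hI i h
    cases i with
    | zero => simpa using hI.1
    | succ i =>
      have := ih _ hI.2 i (by simpa using h)
      simpa [Ideal.ofList_cons, sup_assoc] using this

theorem RegSeq.append {R : Type*} [CommRing R] (l l' : List R) : ∀ (I : Ideal R),
    RegSeq I l → RegSeq (I ⊔ Ideal.ofList l) l' → RegSeq I (l ++ l') := by
  induction l with
  | nil => intro I _ h; simpa using h
  | cons a l ih =>
    intro I hI h
    refine ⟨hI.1, ih _ hI.2 ?_⟩
    simpa [Ideal.ofList_cons, sup_assoc] using h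

theorem RegSeq.congr {R : Type*} [CommRing R] {l l' : List R} (I : Ideal R)
    (h : List.Forall₂ (fun a b => a - b ∈ I) l l') : ∀ J, I ≤ J → RegSeq J l → RegSeq J l' := by
  induction h with
  | nil => intros; trivial
  | @cons a b l l' hab _ ih =>
    intro J hIJ hJ
    have hab := hIJ hab
    have e : J ⊔ Ideal.span {a} = J ⊔ Ideal.span {b} := by
      apply le_antisymm <;> refine sup_le le_sup_left ?_ <;>
        rw [Ideal.span_singleton_le_iff_mem]
      · have : a = (a - b) + b := by ring
        rw [this]
        exact add_mem (Ideal.mem_sup_left hab)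
          (Ideal.mem_sup_right (Ideal.mem_span_singleton_self b))
      · have : b = a - (a - b) := by ring
        rw [this]
        exact sub_mem (Ideal.mem_sup_right (Ideal.mem_span_singleton_self a))
          (Ideal.mem_sup_left hab)
    refine ⟨fun r hr => hJ.1 r ?_, ?_⟩
    · have : a * r = (a - b) * r + b * r := by ring
      rw [this]
      exact add_mem (J.mul_mem_right _ hab) hr
    · rw [← e]
      exact ih _ (hIJ.trans le_sup_left) hJ.2

theorem mem_sup_span {R : Type*} [CommRing R] {I : Ideal R} {b r : R} :
    r ∈ I ⊔ Ideal.span {b} ↔ ∃ s, r - b * s ∈ I := by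
  constructor
  · intro h
    obtain ⟨i, hi, j, hj, rfl⟩ := Submodule.mem_sup.1 h
    obtain ⟨s, rfl⟩ := Ideal.mem_span_singleton'.1 hj
    exact ⟨s, by rw [show i + s * b - b * s = i by ring]; exact hi⟩
  · rintro ⟨s, hs⟩
    have : r = (r - b * s) + b * s := by ring
    rw [this]
    exact add_mem (Ideal.mem_sup_left hs)
      (Ideal.mem_sup_right (Ideal.mul_mem_right _ _ (Ideal.mem_span_singleton_self b)))

section
variable {σ K : Type*} [Field K]

theorem separated (I : Ideal (MvPolynomial σ K)) (hI : I.IsHomogeneous (homogeneousSubmodule σ K))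
    (v : σ) (r : MvPolynomial σ K) (h : ∀ N : ℕ, ∃ s, r - X v ^ N * s ∈ I) : r ∈ I := by
  rw [mem_iff_homogeneousComponent_mem hI]
  intro d
  obtain ⟨s, hs⟩ := h (d + 1)
  have := (mem_iff_homogeneousComponent_mem hI _).1 hs d
  have h0 : homogeneousComponent d (X v ^ (d + 1) * s) = 0 := by
    ext m
    rw [coeff_homogeneousComponent, coeff_zero, X_pow_eq_monomial, coeff_monomial_mul']
    split_ifs with h1 h2
    · have := Finsupp.degree_mono h2
      simp at this
      omega
    · rfl
    · rfl
  rwa [map_sub, h0, sub_zero] at this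

theorem NZMod.swap (I : Ideal (MvPolynomial σ K)) (hI : I.IsHomogeneous (homogeneousSubmodule σ K))
    (v : σ) (a : MvPolynomial σ K) (hb : NZMod I (X v))
    (ha : NZMod (I ⊔ Ideal.span {X v}) a) :
    NZMod I a ∧ NZMod (I ⊔ Ideal.span {a}) (X v) := by
  constructor
  · have key : ∀ N : ℕ, ∀ r, a * r ∈ I → ∃ s, r - X v ^ N * s ∈ I := by
      intro N
      induction N with
      | zero => intro r _; exact ⟨r, by simp⟩
      | succ N ih =>
        intro r hr
        obtain ⟨s, hs⟩ := mem_sup_span.1 (ha r (Ideal.mem_sup_left hr))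
        have h1 : a * s ∈ I := by
          apply hb
          have : X v * (a * s) = a * r - a * (r - X v * s) := by ring
          rw [this]
          exact sub_mem hr (I.mul_mem_left _ hs)
        obtain ⟨t, ht⟩ := ih s h1
        refine ⟨t, ?_⟩
        have : r - X v ^ (N + 1) * t = (r - X v * s) + X v * (s - X v ^ N * t) := by ring
        rw [this]
        exact add_mem hs (I.mul_mem_left _ ht)
    exact fun r hr => separated I hI v r fun N => key N r hr
  · intro r hr
    obtain ⟨s, hs⟩ := mem_sup_span.1 hr
    have h1 : s ∈ I ⊔ Ideal.span {X v} := by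
      apply ha
      refine mem_sup_span.2 ⟨r, ?_⟩
      have : a * s - X v * r = -(X v * r - a * s) := by ring
      rw [this]
      exact neg_mem hs
    obtain ⟨t, ht⟩ := mem_sup_span.1 h1
    refine mem_sup_span.2 ⟨t, hb _ ?_⟩
    have : X v * (r - a * t) = (X v * r - a * s) + a * (s - X v * t) := by ring
    rw [this]
    exact add_mem hs (I.mul_mem_left _ ht)

theorem homog_sup (I : Ideal (MvPolynomial σ K)) (hI : I.IsHomogeneous (homogeneousSubmodule σ K))
    (a : MvPolynomial σ K) (d : ℕ) (ha : a.IsHomogeneous d) :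
    (I ⊔ Ideal.span {a}).IsHomogeneous (homogeneousSubmodule σ K) := by
  refine hI.sup (Ideal.homogeneous_span _ _ ?_)
  rintro x rfl
  exact ⟨d, ha⟩

theorem RegSeq.drop_var (v : σ) (F : List (MvPolynomial σ K)) :
    ∀ (I : Ideal (MvPolynomial σ K)), I.IsHomogeneous (homogeneousSubmodule σ K) →
    (∀ a ∈ F, ∃ d, a.IsHomogeneous d) → RegSeq I (X v :: F) → RegSeq I F := by
  induction F with
  | nil => intros; trivial
  | cons a F ih =>
    intro I hI hF h
    obtain ⟨h1, h2⟩ := NZMod.swap I hI v a h.1 h.2.1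
    obtain ⟨d, hd⟩ := hF a (by simp)
    refine ⟨h1, ih _ (homog_sup I hI a d hd) (fun b hb => hF b (by simp [hb])) ⟨h2, ?_⟩⟩
    have := h.2.2
    rwa [sup_right_comm] at this

theorem RegSeq.drop_vars (B : List σ) (F : List (MvPolynomial σ K))
    (hF : ∀ a ∈ F, ∃ d, a.IsHomogeneous d)
    (I : Ideal (MvPolynomial σ K)) (hI : I.IsHomogeneous (homogeneousSubmodule σ K))
    (h : RegSeq I (B.map X ++ F)) : RegSeq I F := by
  induction B with
  | nil => simpa using h
  | cons b B ih =>
    apply ih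
    refine RegSeq.drop_var b _ I hI ?_ h
    intro a ha
    rcases List.mem_append.1 ha with ha | ha
    · obtain ⟨c, _, rfl⟩ := List.mem_map.1 ha
      exact ⟨1, isHomogeneous_X _ _⟩
    · exact hF a ha

theorem NZMod.monomial (S : Set (σ →₀ ℕ)) (m : σ →₀ ℕ) (h : ∀ s ∈ S, Disjoint s m) :
    NZMod (Ideal.span ((fun s => MvPolynomial.monomial s (1 : K)) '' S))
      (MvPolynomial.monomial m 1) := by
  intro r hr
  rw [mem_ideal_span_monomial_image] at hr ⊢
  intro e he
  obtain ⟨s, hs, hle⟩ := hr (m + e) (by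
    rw [mem_support_iff, coeff_monomial_mul, one_mul]; exact mem_support_iff.1 he)
  refine ⟨s, hs, fun x => ?_⟩
  have h1 := hle x
  have h2 := DFunLike.congr_fun (disjoint_iff.1 (h s hs)) x
  simp only [Finsupp.inf_apply, bot_eq_zero, Finsupp.zero_apply, Finsupp.add_apply] at h1 h2
  omega

theorem RegSeq.monomials (L : List (σ →₀ ℕ)) (hL : L.Pairwise Disjoint) :
    ∀ (S : Set (σ →₀ ℕ)), (∀ s ∈ S, ∀ m ∈ L, Disjoint s m) →
    RegSeq (Ideal.span ((fun s => MvPolynomial.monomial s (1 : K)) '' S))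
      (L.map fun m => MvPolynomial.monomial m 1) := by
  induction hL with
  | nil => intros; trivial
  | @cons m L hm _ ih =>
    intro S hS
    refine ⟨NZMod.monomial S m fun s hs => hS s hs m (by simp), ?_⟩
    have := ih (S ∪ {m}) ?_
    · rwa [Set.image_union, Ideal.span_union, Set.image_singleton] at this
    · rintro s (hs | rfl) t ht
      · exact hS s hs t (by simp [ht])
      · exact hm t ht

end

/-- In `R = K[xᵢⱼ, yᵢⱼ : 1 ≤ i,j ≤ n]`, `n ≥ 2` (variables indexed by
`(Fin n × Fin n) ⊕ (Fin n × Fin n)`, the left summand for the `x`'s and the right one for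
the `y`'s), with `f i j = Σₖ x i k * y k j` the entries of the product of the two generic
`n×n` matrices, the first-column entries `f₁₁, f₂₁, …, f_{n1}` form a regular sequence. -/
theorem firstColumn_product_generic_regularSequence
    {K : Type*} [Field K] (n : ℕ) (hn : 2 ≤ n)
    (f : Fin n → Fin n → MvPolynomial ((Fin n × Fin n) ⊕ (Fin n × Fin n)) K)
    (hf : ∀ i j, f i j = ∑ k, X (Sum.inl (i, k)) * X (Sum.inr (k, j))) :
    RingTheory.Sequence.IsRegular (MvPolynomial ((Fin n × Fin n) ⊕ (Fin n × Fin n)) K)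
      (List.ofFn fun i : Fin n => f i ⟨0, by omega⟩) := by
  set z : Fin n := ⟨0, by omega⟩ with hz
  set B : List (Fin n × Fin n) := (Finset.univ.filter fun p : Fin n × Fin n => p.1 ≠ p.2).toList
    with hB
  have hBmem : ∀ p, p ∈ B ↔ p.1 ≠ p.2 := by intro p; simp [hB]
  let g : Fin n → ((Fin n × Fin n) ⊕ (Fin n × Fin n) →₀ ℕ) := fun i =>
    Finsupp.single (Sum.inl (i, i)) 1 + Finsupp.single (Sum.inr (i, z)) 1
  let b : Fin n × Fin n → ((Fin n × Fin n) ⊕ (Fin n × Fin n) →₀ ℕ) := fun p =>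
    Finsupp.single (Sum.inl p) 1
  have hbb : (B.map b).Pairwise Disjoint := by
    rw [List.pairwise_map]
    refine (Finset.nodup_toList _).imp ?_
    intro p q hpq
    rw [disjoint_iff]
    ext x
    simp only [b, Finsupp.inf_apply, Finsupp.single_apply, bot_eq_zero, Finsupp.zero_apply]
    grind
  have hgg : (List.ofFn g).Pairwise Disjoint := by
    rw [List.pairwise_ofFn]
    intro i j hij
    rw [disjoint_iff]
    ext x
    simp only [g, Finsupp.inf_apply, Finsupp.add_apply, Finsupp.single_apply,
      bot_eq_zero, Finsupp.zero_apply]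
    grind
  have hbg : ∀ p ∈ B, ∀ i, Disjoint (b p) (g i) := by
    intro p hp i
    rw [hBmem] at hp
    rw [disjoint_iff]
    ext x
    simp only [b, g, Finsupp.inf_apply, Finsupp.add_apply, Finsupp.single_apply,
      bot_eq_zero, Finsupp.zero_apply]
    grind
  have hmono : (B.map b).map (fun m => monomial m (1 : K)) = (B.map Sum.inl).map X := by
    simp [b, X, Function.comp_def]
  have h1 : RegSeq (⊥ : Ideal (MvPolynomial ((Fin n × Fin n) ⊕ (Fin n × Fin n)) K))
      ((B.map Sum.inl).map X) := by
    have := RegSeq.monomials (K := K) (B.map b) hbb ∅ (by simp)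
    simpa only [Set.image_empty, Ideal.span_empty, hmono] using this
  have h2 : RegSeq (⊥ ⊔ Ideal.ofList ((B.map Sum.inl).map X) :
      Ideal (MvPolynomial ((Fin n × Fin n) ⊕ (Fin n × Fin n)) K))
      (List.ofFn fun i : Fin n => f i z) := by
    have := RegSeq.monomials (K := K) (List.ofFn g) hgg {m | m ∈ B.map b} (by
      intro s hs m hm
      obtain ⟨p, hp, rfl⟩ := List.mem_map.1 hs
      obtain ⟨i, rfl⟩ := (List.mem_ofFn' _ _).1 hm
      exact hbg p hp i)
    have e : Ideal.span ((fun s => monomial s (1 : K)) '' {m | m ∈ B.map b}) =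
        ⊥ ⊔ Ideal.ofList ((B.map Sum.inl).map X) := by
      rw [bot_sup_eq, ← hmono, Ideal.ofList]
      congr 1
      ext x
      simp
    rw [e] at this
    refine RegSeq.congr _ ?_ _ le_rfl this
    rw [List.map_ofFn, List.forall₂_iff_get]
    refine ⟨by simp, fun i hi hi' => ?_⟩
    simp only [List.get_eq_getElem, List.getElem_ofFn, Function.comp]
    generalize (⟨i, _⟩ : Fin n) = i
    have : monomial (g i) (1 : K) = X (Sum.inl (i, i)) * X (Sum.inr (i, z)) := by
      simp [g, X, monomial_mul]
    rw [this, hf, ← Finset.add_sum_erase _ _ (Finset.mem_univ i), ← sub_sub, sub_self, zero_sub]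
    refine neg_mem (sum_mem fun k hk => Ideal.mul_mem_right _ _ (Ideal.mem_sup_right ?_))
    refine Ideal.subset_span ?_
    have hk := Finset.ne_of_mem_erase hk
    exact List.mem_map_of_mem (List.mem_map_of_mem ((hBmem _).2 hk.symm))
  have h3 : RegSeq ⊥ (List.ofFn fun i : Fin n => f i z) := by
    refine RegSeq.drop_vars (B.map Sum.inl) _ ?_ ⊥ (Ideal.IsHomogeneous.bot _)
      (RegSeq.append _ _ _ h1 h2)
    intro a ha
    obtain ⟨i, rfl⟩ := (List.mem_ofFn' _ _).1 ha
    refine ⟨2, ?_⟩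
    simp only [hf]
    exact IsHomogeneous.sum _ _ _ fun k _ => (isHomogeneous_X _ _).mul (isHomogeneous_X _ _)
  refine ⟨⟨fun i hi => ?_⟩, ?_⟩
  · rw [isSMulRegular_quotient_iff_mem_of_smul_mem]
    have := RegSeq.get _ _ h3 i hi
    rw [bot_sup_eq] at this
    simpa [NZMod] using this
  · intro h
    have h1 : (1 : MvPolynomial ((Fin n × Fin n) ⊕ (Fin n × Fin n)) K) ∈
        Ideal.ofList (List.ofFn fun i : Fin n => f i z) := by
      have : (1 : MvPolynomial ((Fin n × Fin n) ⊕ (Fin n × Fin n)) K) ∈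
        (⊤ : Ideal (MvPolynomial ((Fin n × Fin n) ⊕ (Fin n × Fin n)) K)) := trivial
      rw [h] at this
      simpa using this
    have h2 : Ideal.ofList (List.ofFn fun i : Fin n => f i z) ≤
        RingHom.ker (constantCoeff (R := K)) := by
      refine Ideal.span_le.2 ?_
      intro a ha
      obtain ⟨i, rfl⟩ := (List.mem_ofFn' _ _).1 ha
      simp [hf, RingHom.mem_ker]
    have := h2 h1
    simp [RingHom.mem_ker] at this
end
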